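/- Let L be the Laplacian of a weight-balanced weighted digraph on N vertices with weights wᵢⱼ, out-neighbor sets 𝒩ᵢ = {j : wᵢⱼ > 0}, w_max = max_i max_{j∈𝒩ᵢ} wᵢⱼ, and |𝒩_max| = max_i |𝒩ᵢ|. Then for every x̂ ∈ ℝᴺ, ‖L x̂‖² = x̂ᵀ Lᵀ L x̂ ≤ |𝒩_max| · w_max · Σ_{i=1}^N Σ_{j=1}^N wᵢⱼ (x̂ᵢ − x̂ⱼ)² = 2 |𝒩_max| · w_max · x̂ᵀ L x̂. -/

import Mathlib

open Matrix Finset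

section Laplacian

variable {ι : Type*} [Fintype ι]

theorem laplacian_mulVec_apply [DecidableEq ι] (W : Matrix ι ι ℝ) (x : ι → ℝ) (i : ι) :
    (Matrix.diagonal (fun i => ∑ k, W i k) - W).mulVec x i = ∑ j, W i j * (x i - x j) := by
  simp only [Matrix.sub_mulVec, Pi.sub_apply, Matrix.mulVec_diagonal, mul_sub,
    Finset.sum_sub_distrib, Finset.sum_mul]
  rfl

theorem sum_sq_mulVec_eq_dotProduct (A : Matrix ι ι ℝ) (x : ι → ℝ) :
    ∑ i, (A.mulVec x i) ^ 2 = x ⬝ᵥ (Aᵀ * A).mulVec x := by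
  rw [← Matrix.mulVec_mulVec, Matrix.dotProduct_mulVec, Matrix.vecMul_transpose]
  simp only [dotProduct, sq]

/-- In a weight-balanced digraph the Dirichlet sum is twice the Laplacian quadratic form. -/
theorem sum_weight_mul_sq_sub_eq_of_balanced (W : Matrix ι ι ℝ)
    (hbal : ∀ i, ∑ j, W i j = ∑ j, W j i) (x : ι → ℝ) :
    ∑ i, ∑ j, W i j * (x i - x j) ^ 2 = 2 * ∑ i, x i * ∑ j, W i j * (x i - x j) := by
  have hswap : ∑ i, ∑ j, W i j * x j ^ 2 = ∑ i, ∑ j, W i j * x i ^ 2 := by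
    rw [Finset.sum_comm]
    simp only [← Finset.sum_mul, hbal]
  have hsplit : ∑ i, ∑ j, W i j * (x i - x j) ^ 2 =
      2 * ∑ i, x i * ∑ j, W i j * (x i - x j) +
        (∑ i, ∑ j, W i j * x j ^ 2 - ∑ i, ∑ j, W i j * x i ^ 2) := by
    simp only [Finset.mul_sum, ← Finset.sum_sub_distrib, ← Finset.sum_add_distrib]
    refine Finset.sum_congr rfl fun i _ => Finset.sum_congr rfl fun j _ => ?_
    ring
  rw [hsplit, hswap, sub_self, add_zero]

/-- Cauchy–Schwarz over the support of a nonnegative weight `w` bounded by `c`. -/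
theorem sq_sum_mul_le_card_support_mul (w y : ι → ℝ) (hw : ∀ j, 0 ≤ w j) {c n : ℝ}
    (hc : ∀ j, w j ≤ c) (hn : ((Finset.univ.filter (fun j => 0 < w j)).card : ℝ) ≤ n) :
    (∑ j, w j * y j) ^ 2 ≤ n * c * ∑ j, w j * y j ^ 2 := by
  have hsupp : ∑ j ∈ Finset.univ.filter (fun j => 0 < w j), w j * y j = ∑ j, w j * y j := by
    refine Finset.sum_filter_of_ne fun j _ hj => (hw j).lt_of_ne' ?_
    exact left_ne_zero_of_mul hj
  calc (∑ j, w j * y j) ^ 2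
      ≤ (Finset.univ.filter (fun j => 0 < w j)).card *
          ∑ j ∈ Finset.univ.filter (fun j => 0 < w j), (w j * y j) ^ 2 := by
        rw [← hsupp]
        exact sq_sum_le_card_mul_sum_sq
    _ ≤ n * ∑ j, (w j * y j) ^ 2 := by
        refine mul_le_mul hn ?_ (Finset.sum_nonneg fun j _ => sq_nonneg _)
          ((Nat.cast_nonneg _).trans hn)
        exact Finset.sum_le_sum_of_subset_of_nonneg (Finset.filter_subset _ _)
          fun j _ _ => sq_nonneg _
    _ ≤ n * ∑ j, c * (w j * y j ^ 2) := by
        refine mul_le_mul_of_nonneg_left (Finset.sum_le_sum fun j _ => ?_)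
          ((Nat.cast_nonneg _).trans hn)
        calc (w j * y j) ^ 2 = w j * (w j * y j ^ 2) := by ring
          _ ≤ c * (w j * y j ^ 2) :=
            mul_le_mul_of_nonneg_right (hc j) (mul_nonneg (hw j) (sq_nonneg _))
    _ = n * c * ∑ j, w j * y j ^ 2 := by rw [← Finset.mul_sum, mul_assoc]

end Laplacian

/-- for a weight-balanced digraph with Laplacian `L`, out-neighbor sets
`𝒩ᵢ = {j : wᵢⱼ > 0}` (all nonempty), `w_max = maxᵢ max_{j∈𝒩ᵢ} wᵢⱼ` and
`|𝒩_max| = maxᵢ |𝒩ᵢ|`: for every `x̂ ∈ ℝᴺ`,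
`‖L x̂‖² = x̂ᵀ Lᵀ L x̂ ≤ |𝒩_max| w_max ∑ᵢ ∑ⱼ wᵢⱼ(x̂ᵢ - x̂ⱼ)² = 2 |𝒩_max| w_max x̂ᵀ L x̂`. -/
theorem laplacian_vector_norm_sq_bound
    (N : ℕ) (hN : 0 < N) (W : Matrix (Fin N) (Fin N) ℝ)
    (hWnn : ∀ i j, 0 ≤ W i j) (hWdiag : ∀ i, W i i = 0)
    (hbal : ∀ i, ∑ j, W i j = ∑ j, W j i)
    (hne : ∀ i, (Finset.univ.filter (fun j => 0 < W i j)).Nonempty)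
    (L : Matrix (Fin N) (Fin N) ℝ)
    (hL : L = Matrix.diagonal (fun i => ∑ k, W i k) - W)
    (wmax Nmax : ℝ)
    (hwmax : wmax = Finset.univ.sup' ⟨⟨0, hN⟩, Finset.mem_univ _⟩
      (fun i => (Finset.univ.filter (fun j => 0 < W i j)).sup' (hne i) (fun j => W i j)))
    (hNmax : Nmax = Finset.univ.sup' ⟨⟨0, hN⟩, Finset.mem_univ _⟩
      (fun i => ((Finset.univ.filter (fun j => 0 < W i j)).card : ℝ)))
    (xhat : Fin N → ℝ) :
    ∑ i, (L.mulVec xhat i)^2 = xhat ⬝ᵥ (Lᵀ * L).mulVec xhat ∧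
    ∑ i, (L.mulVec xhat i)^2
      ≤ Nmax * wmax * ∑ i, ∑ j, W i j * (xhat i - xhat j)^2 ∧
    Nmax * wmax * ∑ i, ∑ j, W i j * (xhat i - xhat j)^2
      = 2 * Nmax * wmax * (xhat ⬝ᵥ L.mulVec xhat) := by
  have hle_sup : ∀ i j, 0 < W i j → W i j ≤ wmax := fun i j hij => by
    rw [hwmax]
    exact (Finset.le_sup' (fun j => W i j) (by simpa using hij)).trans
      (Finset.le_sup' (fun i => (Finset.univ.filter (fun j => 0 < W i j)).sup' (hne i)
        (fun j => W i j)) (Finset.mem_univ i))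
  have hwmax_nonneg : 0 ≤ wmax := by
    obtain ⟨j, hj⟩ := hne ⟨0, hN⟩
    exact (hWnn _ _).trans (hle_sup _ j (by simpa using hj))
  have hle : ∀ i j, W i j ≤ wmax := fun i j =>
    (hWnn i j).eq_or_lt.elim (fun h => h ▸ hwmax_nonneg) (hle_sup i j)
  have hcard : ∀ i, ((Finset.univ.filter (fun j => 0 < W i j)).card : ℝ) ≤ Nmax := fun i => by
    rw [hNmax]
    exact Finset.le_sup' (fun i => ((Finset.univ.filter (fun j => 0 < W i j)).card : ℝ))
      (Finset.mem_univ i)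
  have hLx : ∀ i, L.mulVec xhat i = ∑ j, W i j * (xhat i - xhat j) :=
    fun i => hL ▸ laplacian_mulVec_apply W xhat i
  refine ⟨sum_sq_mulVec_eq_dotProduct L xhat, ?_, ?_⟩
  · rw [Finset.mul_sum]
    refine Finset.sum_le_sum fun i _ => ?_
    rw [hLx]
    exact sq_sum_mul_le_card_support_mul (W i) (fun j => xhat i - xhat j) (hWnn i) (hle i)
      (hcard i)
  · rw [sum_weight_mul_sq_sub_eq_of_balanced W hbal]
    simp only [dotProduct, hLx]
    ring
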